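/- arXiv:1810.03062 — 3 statements merged into one kernel-verified Lean document; each statement's English description precedes it below -/
import Mathlib

section
/- Fix k ≥ 3. Let Δ_k = (ℤ/kℤ) ⋊_φ ℤ, where φ : ℤ → Aut(ℤ/kℤ) sends 1 to the inversion automorphism, with generating set T_k = {(i,0) : i ∈ ℤ/kℤ, i ≠ 0} ∪ {(i,1) : i ∈ ℤ/kℤ, i ≠ 0,1} ∪ {(i,-1) : i ∈ ℤ/kℤ, i ≠ 0,1}. Then the Borel chromatic number of the shift graph of (Δ_k,T_k) equals k+1. -/
open Multiplicative

section Defs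

variable {G : Type*} [Group G]

/-- The left shift action of `g : G` on `x : G → Bool` (`2^G` with `2 = Bool`):
`(g · x)(h) = x (g⁻¹ h)`. -/
def shiftMap (g : G) (x : G → Bool) : G → Bool := fun h => x (g⁻¹ * h)

/-- The free part `F(2^G)` of the left shift action. -/
def FreePart (G : Type*) [Group G] : Set (G → Bool) :=
  {x | ∀ g : G, g ≠ 1 → shiftMap g x ≠ x}

/-- Adjacency in the shift graph of the marked group `(G, S)`: distinct `x, y ∈ F(2^G)`
are adjacent iff `y = s · x` for some `s ∈ S`. -/
def ShiftAdj (S : Set G) (x y : FreePart G) : Prop :=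
  x ≠ y ∧ ∃ s ∈ S, (y : G → Bool) = shiftMap s (x : G → Bool)

/-- Adjacency in the Cayley graph of `(G, S)`: distinct `g, h` are adjacent iff
`h = s * g` for some `s ∈ S`. -/
def CayleyAdj (S : Set G) (g h : G) : Prop :=
  g ≠ h ∧ ∃ s ∈ S, h = s * g

/-- `(G, S)` is a marked group: `S` is a finite symmetric generating set
not containing the identity. -/
def IsMarkedGroup (S : Set G) : Prop :=
  S.Finite ∧ (∀ s ∈ S, s⁻¹ ∈ S) ∧ (1 : G) ∉ S ∧ Subgroup.closure S = ⊤

end Defs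

/-- A graph (given by its adjacency relation) has an `n`-coloring. -/
def HasColoring {X : Type*} (Adj : X → X → Prop) (n : ℕ) : Prop :=
  ∃ c : X → Fin n, ∀ x y, Adj x y → c x ≠ c y

/-- The chromatic number: the least `n` admitting an `n`-coloring. -/
noncomputable def chromatic {X : Type*} (Adj : X → X → Prop) : ℕ :=
  sInf {n | HasColoring Adj n}

/-- A graph on a measurable space has a Borel `n`-coloring. -/
def HasBorelColoring {X : Type*} [MeasurableSpace X] (Adj : X → X → Prop) (n : ℕ) : Prop :=
  ∃ c : X → Fin n, Measurable c ∧ ∀ x y, Adj x y → c x ≠ c y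

/-- The Borel chromatic number: the least `n` admitting a Borel `n`-coloring. -/
noncomputable def borelChromatic {X : Type*} [MeasurableSpace X] (Adj : X → X → Prop) : ℕ :=
  sInf {n | HasBorelColoring Adj n}
/-- The homomorphism `ℤ → Aut(ℤ/kℤ)` (written multiplicatively) sending `1` to the
inversion automorphism `i ↦ -i`. -/
def phiK (k : ℕ) : Multiplicative ℤ →* MulAut (Multiplicative (ZMod k)) :=
  zpowersHom (MulAut (Multiplicative (ZMod k))) (MulEquiv.inv (Multiplicative (ZMod k)))

/-- The marked group `Δ_k = ℤ/kℤ ⋊_φ ℤ`, `φ` sending `1` to inversion. -/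
abbrev DeltaK (k : ℕ) : Type :=
  SemidirectProduct (Multiplicative (ZMod k)) (Multiplicative ℤ) (phiK k)

/-- The generating set
`T_k = {(i,0) : i ≠ 0} ∪ {(i,1) : i ≠ 0,1} ∪ {(i,-1) : i ≠ 0,1}` of `Δ_k`. -/
def TK (k : ℕ) : Set (DeltaK k) :=
  {x | ∃ i : ZMod k, i ≠ 0 ∧ x = ⟨ofAdd i, ofAdd (0 : ℤ)⟩} ∪
  {x | ∃ i : ZMod k, i ≠ 0 ∧ i ≠ 1 ∧ x = ⟨ofAdd i, ofAdd (1 : ℤ)⟩} ∪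
  {x | ∃ i : ZMod k, i ≠ 0 ∧ i ≠ 1 ∧ x = ⟨ofAdd i, ofAdd (-1 : ℤ)⟩}


section Generic

variable {G : Type*} [Group G]

theorem shiftMap_mul (g h : G) (x : G → Bool) :
    shiftMap (g * h) x = shiftMap g (shiftMap h x) := by
  funext a; simp [shiftMap, mul_assoc]

theorem shiftMap_one (x : G → Bool) : shiftMap (1 : G) x = x := by
  funext a; simp [shiftMap]

theorem shiftMap_mem_freePart (g : G) {x : G → Bool} (hx : x ∈ FreePart G) :
    shiftMap g x ∈ FreePart G := by
  intro h hh heq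
  refine hx (g⁻¹ * h * g) ?_ ?_
  · intro h1
    apply hh
    have : h = g * (g⁻¹ * h * g) * g⁻¹ := by group
    rw [this, h1]; group
  · rw [mul_assoc, shiftMap_mul, shiftMap_mul, heq, ← shiftMap_mul]
    simp [shiftMap_one]

instance freePartAction : MulAction G (FreePart G) where
  smul g x := ⟨shiftMap g x.1, shiftMap_mem_freePart g x.2⟩
  one_smul _ := Subtype.ext (shiftMap_one _)
  mul_smul g h _ := Subtype.ext (shiftMap_mul g h _)

theorem coe_smul_freePart (g : G) (x : FreePart G) :
    ((g • x : FreePart G) : G → Bool) = shiftMap g x.1 := rfl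

theorem freePart_free (g : G) (x : FreePart G) (h : g • x = x) : g = 1 := by
  by_contra hg
  exact x.2 g hg (congrArg Subtype.val h)

theorem freePart_inj {g h : G} {x : FreePart G} (e : g • x = h • x) : g = h := by
  have : (h⁻¹ * g) • x = x := by rw [mul_smul, e, ← mul_smul]; simp
  have := freePart_free _ _ this
  exact (inv_mul_eq_one.mp this).symm

theorem continuous_shiftMap (g : G) : Continuous (shiftMap g) :=
  continuous_pi fun h => continuous_apply (g⁻¹ * h)

theorem isOpenMap_shiftMap (g : G) : IsOpenMap (shiftMap g) := by
  refine IsOpenMap.of_inverse (f' := shiftMap g⁻¹) (continuous_shiftMap _) ?_ ?_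
  · intro x; rw [← shiftMap_mul]; simp [shiftMap_one]
  · intro x; rw [← shiftMap_mul]; simp [shiftMap_one]

theorem continuous_smul_freePart (g : G) : Continuous (fun x : FreePart G => g • x) :=
  ((continuous_shiftMap g).comp continuous_subtype_val).subtype_mk _

theorem shiftAdj_iff (S : Set G) (hS : (1 : G) ∉ S) (x y : FreePart G) :
    ShiftAdj S x y ↔ ∃ s ∈ S, y = s • x := by
  constructor
  · rintro ⟨_, s, hs, h⟩
    exact ⟨s, hs, Subtype.ext h⟩
  · rintro ⟨s, hs, rfl⟩
    refine ⟨fun h => hS ?_, s, hs, rfl⟩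
    rw [← freePart_free s x h.symm]; exact hs

theorem exists_agree {G : Type*} {U : Set (G → Bool)} (hU : IsOpen U) {x : G → Bool} (hx : x ∈ U) :
    ∃ I : Finset G, ∀ y : G → Bool, (∀ h ∈ I, y h = x h) → y ∈ U := by
  obtain ⟨I, u, h1, h2⟩ := isOpen_pi_iff.1 hU x hx
  refine ⟨I, fun y hy => h2 ?_⟩
  intro a ha
  rw [hy a ha]; exact (h1 a ha).2

theorem freePart_residual [Countable G] [Infinite G] : FreePart G ∈ residual (G → Bool) := by
  classical
  have : FreePart G = ⋂ g : G, {x | g ≠ 1 → shiftMap g x ≠ x} := by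
    ext x; simp [FreePart]
  rw [this, countable_iInter_mem]
  intro g
  by_cases hg : g = 1
  · simp [hg]
  simp only [ne_eq, hg, not_false_eq_true, forall_const]
  refine residual_of_dense_open ?_ ?_
  · exact isOpen_ne_fun (continuous_shiftMap g) continuous_id
  · rw [dense_iff_inter_open]
    rintro U hU ⟨x, hx⟩
    obtain ⟨I, hI⟩ := exists_agree hU hx
    obtain ⟨h, hh⟩ := Infinite.exists_notMem_finset (I ∪ I.image (fun a => g * a))
    simp only [Finset.mem_union, Finset.mem_image, not_or, not_exists, not_and] at hh
    refine ⟨fun a => if a ∈ I then x a else if a = h then true else false, hI _ ?_, ?_⟩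
    · intro a ha; simp [ha]
    · intro he
      have := congrFun he h
      have h1 : g⁻¹ * h ∉ I := fun hm => hh.2 _ hm (by simp)
      simp [shiftMap, hh.1, h1, hg] at this

/-- Generic ergodicity: no Borel set of the free part is exchanged with its complement by `t`. -/
theorem no_swap_set [Countable G] [Infinite G] (t : G)
    (ht : ∀ I : Finset G, ∃ n : ℕ, Odd n ∧ ∀ h ∈ I, (t ^ n)⁻¹ * h ∉ I)
    (B : Set (FreePart G)) (hB : MeasurableSet B) (hs : ∀ x, t • x ∈ B ↔ x ∉ B) : False := by
  classical
  have hF := freePart_residual (G := G)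
  have hFm : MeasurableSet (FreePart G) := by
    have : FreePart G = ⋂ g : G, {x | g ≠ 1 → shiftMap g x ≠ x} := by
      ext x; simp [FreePart]
    rw [this]
    refine MeasurableSet.iInter fun g => ?_
    by_cases hg : g = 1
    · simp [hg]
    simp only [ne_eq, hg, not_false_eq_true, forall_const]
    exact (isOpen_ne_fun (continuous_shiftMap g) continuous_id).measurableSet
  have hodd : ∀ n : ℕ, Odd n → ∀ x : FreePart G, t ^ n • x ∈ B ↔ x ∉ B := by
    rintro n ⟨m, rfl⟩
    induction m with
    | zero => simpa using hs
    | succ m ih =>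
      intro x
      rw [show 2 * (m + 1) + 1 = 1 + (1 + (2 * m + 1)) by ring, pow_add, pow_add, mul_smul,
        mul_smul, pow_one, hs, hs, ih, not_not]
  have hB' : MeasurableSet (Subtype.val '' B) := hFm.subtype_image hB
  obtain ⟨U, hU, hBU⟩ := hB'.residualEq_isOpen
  have hBU' : ∀ᶠ x in residual (G → Bool), x ∈ Subtype.val '' B ↔ x ∈ U := hBU.mem_iff
  have key : ∃ n : ℕ, Odd n ∧ (U = ∅ ∨ (U ∩ shiftMap (t ^ n) ⁻¹' U).Nonempty) := by
    rcases U.eq_empty_or_nonempty with h | ⟨x, hx⟩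
    · exact ⟨1, odd_one, Or.inl h⟩
    obtain ⟨I, hI⟩ := exists_agree hU hx
    obtain ⟨n, hn, hnI⟩ := ht I
    refine ⟨n, hn, Or.inr ⟨fun a => if a ∈ I then x a else x (t ^ n * a), hI _ ?_, hI _ ?_⟩⟩
    · intro h hh; simp [hh]
    · intro h hh
      simp [shiftMap, hnI h hh]
  obtain ⟨n, hn, hcase⟩ := key
  have hsh : ∀ᶠ x in residual (G → Bool),
      (shiftMap (t ^ n) x ∈ Subtype.val '' B ↔ shiftMap (t ^ n) x ∈ U) :=
    (tendsto_residual_of_isOpenMap (continuous_shiftMap _) (isOpenMap_shiftMap _)).eventually hBU'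
  have hall := (hBU'.and hsh).and hF
  have hd := dense_of_mem_residual hall
  have hmem : ∀ x : FreePart G, x.1 ∈ Subtype.val '' B ↔ x ∈ B := by
    intro x; simp
  rcases hcase with rfl | hne
  · obtain ⟨x, ⟨h1, h2⟩, h3⟩ := hd.nonempty
    have e1 := hmem ⟨x, h3⟩
    have e2 := hmem (t ^ n • ⟨x, h3⟩)
    have e3 := hodd n hn ⟨x, h3⟩
    rw [coe_smul_freePart] at e2
    simp only [Set.mem_empty_iff_false, iff_false] at h1 h2
    tauto
  · obtain ⟨x, ⟨hu1, hu2⟩, ⟨h1, h2⟩, h3⟩ :=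
      hd.inter_open_nonempty _ (hU.inter (hU.preimage (continuous_shiftMap _))) hne
    have e1 := hmem ⟨x, h3⟩
    have e2 := hmem (t ^ n • ⟨x, h3⟩)
    have e3 := hodd n hn ⟨x, h3⟩
    rw [coe_smul_freePart] at e2
    have hu2' : shiftMap (t ^ n) x ∈ U := hu2
    tauto

/-- Maximal `E`-discrete Borel sets exist in the free part. -/
theorem exists_marker [Countable G] (E : Set G) (hE : E.Finite) (hE1 : (1 : G) ∉ E)
    (hEs : ∀ g ∈ E, g⁻¹ ∈ E) :
    ∃ M : Set (FreePart G), MeasurableSet M ∧ (∀ x ∈ M, ∀ g ∈ E, g • x ∉ M) ∧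
      ∀ x ∉ M, ∃ g ∈ E, g • x ∈ M := by
  classical
  obtain ⟨b, hbc, -, hb⟩ := TopologicalSpace.exists_countable_basis (FreePart G)
  have hbc' : (insert ∅ b).Countable := hbc.insert ∅
  obtain ⟨U, hUr⟩ := hbc'.exists_eq_range (Set.insert_nonempty _ _)
  have hUo : ∀ n, IsOpen (U n) := by
    intro n
    have : U n ∈ insert ∅ b := hUr ▸ Set.mem_range_self n
    rcases this with h | h
    · rw [h]; exact isOpen_empty
    · exact hb.isOpen h
  let M : ℕ → Set (FreePart G) := fun n => Nat.rec ∅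
    (fun n Mn => Mn ∪ ({x | x ∈ U n ∧ ∀ g ∈ E, g • x ∉ U n} ∩ {x | ∀ g ∈ E, g • x ∉ Mn})) n
  have hM0 : M 0 = ∅ := rfl
  have hMs : ∀ n, M (n + 1) =
    M n ∪ ({x | x ∈ U n ∧ ∀ g ∈ E, g • x ∉ U n} ∩ {x | ∀ g ∈ E, g • x ∉ M n}) := fun _ => rfl
  have hmono : Monotone M := monotone_nat_of_le_succ fun n => by
    rw [hMs]; exact Set.subset_union_left
  have hav : ∀ A : Set (FreePart G), MeasurableSet A →
      MeasurableSet {x : FreePart G | ∀ g ∈ E, g • x ∉ A} := by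
    intro A hA
    have : {x : FreePart G | ∀ g ∈ E, g • x ∉ A} = ⋂ g ∈ E, (fun x => g • x) ⁻¹' Aᶜ := by
      ext x; simp
    rw [this]
    exact MeasurableSet.biInter hE.countable fun g _ =>
      (continuous_smul_freePart g).measurable hA.compl
  have hmeas : ∀ n, MeasurableSet (M n) := by
    intro n
    induction n with
    | zero => rw [hM0]; exact MeasurableSet.empty
    | succ n ih =>
      rw [hMs]
      refine ih.union (MeasurableSet.inter ?_ (hav _ ih))
      exact (hUo n).measurableSet.inter (hav _ (hUo n).measurableSet)
  have hdisc : ∀ n, ∀ x ∈ M n, ∀ g ∈ E, g • x ∉ M n := by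
    intro n
    induction n with
    | zero => intro x hx; simp [hM0] at hx
    | succ n ih =>
      intro x hx g hg hgx
      rw [hMs] at hx hgx
      rcases hx with hx | ⟨hx1, hx2⟩ <;> rcases hgx with hy | ⟨hy1, hy2⟩
      · exact ih x hx g hg hy
      · refine hy2 g⁻¹ (hEs g hg) ?_
        simpa using hx
      · exact hx2 g hg hy
      · exact hx1.2 g hg hy1.1
  refine ⟨⋃ n, M n, MeasurableSet.iUnion hmeas, ?_, ?_⟩
  · intro x hx g hg hgx
    obtain ⟨n, hn⟩ := Set.mem_iUnion.1 hx
    obtain ⟨m, hm⟩ := Set.mem_iUnion.1 hgx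
    exact hdisc (max n m) x (hmono (le_max_left _ _) hn) g hg (hmono (le_max_right _ _) hm)
  · intro x hx
    have hfin : ((fun g : G => g • x) '' E).Finite := hE.image _
    have hxn : x ∈ ((fun g : G => g • x) '' E)ᶜ := by
      rintro ⟨g, hg, hgx⟩
      exact hE1 (freePart_free g x hgx ▸ hg)
    obtain ⟨V, hVb, hxV, hV⟩ := hb.exists_subset_of_mem_open hxn hfin.isClosed.isOpen_compl
    obtain ⟨n, hn⟩ : V ∈ Set.range U := hUr ▸ Set.mem_insert_of_mem _ hVb
    by_contra hcon
    push Not at hcon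
    apply hx
    refine Set.mem_iUnion.2 ⟨n + 1, ?_⟩
    rw [hMs]
    refine Or.inr ⟨⟨hn ▸ hxV, ?_⟩, ?_⟩
    · intro g hg hgU
      rw [hn] at hgU
      exact hV hgU ⟨g, hg, rfl⟩
    · intro g hg hgM
      exact hcon g hg (Set.mem_iUnion.2 ⟨n, hgM⟩)

end Generic

section Paths

variable {α : Type*}

/-- Two consecutive layers of seatings are compatible. -/
def SeatStep (p q : Equiv.Perm (Option α)) : Prop :=
  ∀ a b : α, a ≠ b → p (some a) ≠ q (some b)

theorem seatStep_refl (p : Equiv.Perm (Option α)) : SeatStep p p := by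
  intro a b h e
  exact h (Option.some_injective _ (p.injective e))

theorem seatStep_swap [DecidableEq α] (p : Equiv.Perm (Option α)) (c : α) :
    SeatStep p (p * Equiv.swap none (some c)) := by
  intro a b h e
  rw [Equiv.Perm.mul_apply] at e
  have := p.injective e
  by_cases hb : b = c
  · subst hb; simp at this
  · rw [Equiv.swap_apply_of_ne_of_ne (by simp) (by simpa using hb)] at this
    exact h (Option.some_injective _ this)

/-- There is a compatible path from the identity to `p`, stationary after time `n`. -/
def SeatPath (p : Equiv.Perm (Option α)) (n : ℕ) (Q : ℕ → Equiv.Perm (Option α)) : Prop :=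
  Q 0 = 1 ∧ (∀ m, n ≤ m → Q m = p) ∧ ∀ m, SeatStep (Q m) (Q (m + 1))

theorem seatPath_swap_none [DecidableEq α] {p : Equiv.Perm (Option α)} (c : α)
    (h : ∃ n Q, SeatPath p n Q) : ∃ n Q, SeatPath (p * Equiv.swap none (some c)) n Q := by
  obtain ⟨n, Q, h0, hn, hs⟩ := h
  refine ⟨n + 1, fun m => if m ≤ n then Q m else p * Equiv.swap none (some c), ?_, ?_, ?_⟩
  · simp [h0]
  · intro m hm
    simp [show ¬ m ≤ n by omega]
  · intro m
    by_cases h1 : m + 1 ≤ n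
    · simpa [h1, show m ≤ n by omega] using hs m
    · by_cases h2 : m ≤ n
      · have : m = n := by omega
        subst this
        simp only [le_refl, if_true, h1, if_false, hn m le_rfl]
        exact seatStep_swap p c
      · simp only [h1, h2, if_false]
        exact seatStep_refl _

theorem exists_seatPath [Finite α] (p : Equiv.Perm (Option α)) : ∃ n Q, SeatPath p n Q := by
  classical
  induction p using Equiv.Perm.swap_induction_on' with
  | one => exact ⟨0, fun _ => 1, rfl, fun _ _ => rfl, fun _ => seatStep_refl _⟩
  | mul_swap f x y hxy ih =>
    rcases x with _ | x
    · rcases y with _ | y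
      · exact absurd rfl hxy
      · exact seatPath_swap_none y ih
    · rcases y with _ | y
      · rw [Equiv.swap_comm]; exact seatPath_swap_none x ih
      · have h := seatPath_swap_none x (seatPath_swap_none y (seatPath_swap_none x ih))
        have e : Equiv.swap (some x) (some y) =
            Equiv.swap none (some x) * Equiv.swap none (some y) * Equiv.swap none (some x) := by
          rw [Equiv.swap_comm none (some y), Equiv.swap_mul_swap_mul_swap (by simp) hxy.symm]
        rw [e, ← mul_assoc, ← mul_assoc]; exact h

theorem exists_seatPaths (α : Type*) [Finite α] :
    ∃ (N : ℕ) (Q : Equiv.Perm (Option α) → ℕ → Equiv.Perm (Option α)),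
      ∀ p, SeatPath p N (Q p) := by
  classical
  choose n Q h using fun p : Equiv.Perm (Option α) => exists_seatPath p
  obtain ⟨N, hN⟩ := (Set.finite_range n).bddAbove
  refine ⟨N, Q, fun p => ⟨(h p).1, fun m hm => (h p).2.1 m ?_, (h p).2.2⟩⟩
  exact (hN (Set.mem_range_self p)).trans hm

end Paths

section Delta

variable {k : ℕ}

/-- The element `(i, 0)`. -/
def dR (i : ZMod k) : DeltaK k := SemidirectProduct.inl (ofAdd i)

/-- The element `(0, n)`. -/
def dT (k : ℕ) (n : ℤ) : DeltaK k := SemidirectProduct.inr (ofAdd n)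

/-- The height of an element. -/
def dH (g : DeltaK k) : ℤ := toAdd g.right

theorem dH_mul (g h : DeltaK k) : dH (g * h) = dH g + dH h := by simp [dH]
theorem dH_inv (g : DeltaK k) : dH g⁻¹ = - dH g := by simp [dH]
theorem dH_one : dH (1 : DeltaK k) = 0 := by simp [dH]
theorem dH_R (i : ZMod k) : dH (dR i) = 0 := by simp [dH, dR]
theorem dH_T (n : ℤ) : dH (dT k n) = n := by simp [dH, dT]

theorem dR_add (i j : ZMod k) : dR (i + j) = dR i * dR j := by
  simp [dR]
theorem dR_inj {i j : ZMod k} (h : dR i = dR j) : i = j := by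
  simpa [dR] using h
theorem dR_zero : dR (0 : ZMod k) = 1 := by simp [dR]
theorem dT_add (m n : ℤ) : dT k (m + n) = dT k m * dT k n := by simp [dT]
theorem dT_zero : dT k 0 = 1 := by simp [dT]

theorem dT_mul_dR (i : ZMod k) : dT k 1 * dR i = dR (-i) * dT k 1 := by
  have h : phiK k (ofAdd 1) (ofAdd i) = ofAdd (-i) := by
    simp [phiK, zpowersHom_apply]
  ext
  · simp [dT, dR, h]
  · simp [dT, dR]

theorem exists_dR {g : DeltaK k} (h : dH g = 0) : ∃ i, g = dR i := by
  refine ⟨toAdd g.left, ?_⟩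
  have h' : g.right = 1 := h
  ext <;> simp [dR, h']

theorem mk_eq (i : ZMod k) (n : ℤ) :
    (⟨ofAdd i, ofAdd n⟩ : DeltaK k) = dR i * dT k n := by
  ext <;> simp [dR, dT]

theorem mem_TK {g : DeltaK k} : g ∈ TK k ↔
    (∃ i : ZMod k, i ≠ 0 ∧ g = dR i) ∨
    (∃ i : ZMod k, i ≠ 0 ∧ i ≠ 1 ∧ g = dR i * dT k 1) ∨
    (∃ i : ZMod k, i ≠ 0 ∧ i ≠ 1 ∧ g = dR i * dT k (-1)) := by
  simp only [TK, mk_eq, Set.mem_union, Set.mem_ofPred_eq, dT_zero, mul_one, or_assoc]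

theorem one_notMem_TK : (1 : DeltaK k) ∉ TK k := by
  rw [mem_TK]
  rintro (⟨i, hi, h⟩ | ⟨i, hi, -, h⟩ | ⟨i, hi, -, h⟩)
  · rw [← dR_zero] at h; exact hi (dR_inj h).symm
  · have := congrArg dH h
    simp [dH_mul, dH_R, dH_T, dH_one] at this
  · have := congrArg dH h
    simp [dH_mul, dH_R, dH_T, dH_one] at this

instance deltaCountable (k : ℕ) : Countable (DeltaK k) := by
  have : Countable (Multiplicative (ZMod k) × Multiplicative ℤ) := by
    have : Countable (ZMod k) := by
      cases k
      · exact inferInstanceAs (Countable ℤ)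
      · exact inferInstanceAs (Countable (Fin _))
    have h1 : Countable (Multiplicative (ZMod k)) := this
    have h2 : Countable (Multiplicative ℤ) := inferInstanceAs (Countable ℤ)
    infer_instance
  exact Countable.of_equiv _ (SemidirectProduct.equivProd (φ := phiK k)).symm

instance deltaInfinite (k : ℕ) : Infinite (DeltaK k) :=
  Infinite.of_injective (dT k) fun m n h => by
    have := congrArg dH h
    simpa [dH_T] using this

theorem heights_finite [NeZero k] (N : ℕ) : {g : DeltaK k | |dH g| ≤ N}.Finite := by
  have hs : (Set.univ : Set (Multiplicative (ZMod k))).Finite := by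
    have : Finite (ZMod k) := inferInstance
    have : Finite (Multiplicative (ZMod k)) := this
    exact Set.finite_univ
  have ht : {z : Multiplicative ℤ | |toAdd z| ≤ N}.Finite := by
    have : (Set.Icc (-(N : ℤ)) N).Finite := Set.finite_Icc _ _
    refine (this.image ofAdd).subset ?_
    intro z hz
    exact ⟨toAdd z, abs_le.1 hz, rfl⟩
  have := (hs.prod ht).preimage (f := SemidirectProduct.equivProd (φ := phiK k))
    (SemidirectProduct.equivProd.injective.injOn)
  refine this.subset ?_
  intro g hg
  exact ⟨trivial, hg⟩

/-- Seat coordinates: `T^{-d} R^s`. -/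
def dP (d : ℤ) (s : ZMod k) : DeltaK k := dT k (-d) * dR s

theorem dH_P (d : ℤ) (s : ZMod k) : dH (dP d s) = -d := by
  simp [dP, dH_mul, dH_R, dH_T]

theorem dP_inj {d : ℤ} {s s' : ZMod k} (h : dP d s = dP d s') : s = s' :=
  dR_inj (mul_left_cancel h)

theorem exists_dP {g : DeltaK k} {d : ℤ} (h : dH g = -d) : ∃ s, g = dP d s := by
  obtain ⟨s, hs⟩ := exists_dR (g := (dT k (-d))⁻¹ * g) (by simp [dH_mul, dH_inv, dH_T, h])
  exact ⟨s, by rw [dP, ← hs]; simp⟩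

theorem dR_mul_dP {i : ZMod k} (hi : i ≠ 0) (d : ℤ) (s : ZMod k) :
    ∃ s', s' ≠ s ∧ dR i * dP d s = dP d s' := by
  obtain ⟨s', hs⟩ := exists_dP (g := dR i * dP d s) (d := d) (by simp [dH_mul, dH_R, dH_P])
  refine ⟨s', ?_, hs⟩
  rintro rfl
  have h1 : dR i = dR 0 := by rw [dR_zero]; exact mul_eq_right.1 hs
  exact hi (dR_inj h1)

theorem dT_mul_dP (d : ℤ) (s : ZMod k) : dT k 1 * dP d s = dP (d - 1) s := by
  rw [dP, dP, ← mul_assoc, ← dT_add]; congr 2; ring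

/-- Seat transition of a marker. -/
noncomputable def seatTau [NeZero k] (L : ℤ) (s₀ : ZMod k) : Equiv.Perm (Option (ZMod k)) :=
  Equiv.optionCongr (Equiv.ofBijective
    (fun s : ZMod k => toAdd (dP L s * (dP L s₀)⁻¹).left) (by
      refine Finite.injective_iff_bijective.1 ?_
      intro a b h
      have hh : ∀ s : ZMod k, dP L s * (dP L s₀)⁻¹ =
          dR (toAdd (dP L s * (dP L s₀)⁻¹).left) := by
        intro s
        obtain ⟨i, hi⟩ := exists_dR (g := dP L s * (dP L s₀)⁻¹)
          (by simp [dH_mul, dH_P, dH_inv])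
        rw [hi]; simp [dR]
      have : dP L a * (dP L s₀)⁻¹ = dP L b * (dP L s₀)⁻¹ := by
        rw [hh a, hh b]; exact congrArg dR h
      exact dP_inj (mul_right_cancel this)))

theorem seatTau_some [NeZero k] {L : ℤ} {s₀ s u : ZMod k}
    (h : dP L s * (dP L s₀)⁻¹ = dR u) : seatTau L s₀ (some s) = some u := by
  simp only [seatTau, Equiv.optionCongr_apply, Option.map_some, Equiv.ofBijective_apply, h]
  simp [dR]

end Delta

section Upper

variable {k : ℕ}

/-- `m = (T^{-d} R^s)⁻¹ x` is the next marker after `x`. -/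
def IsNext (M : Set (FreePart (DeltaK k))) (x : FreePart (DeltaK k)) (d : ℕ) (s : ZMod k) : Prop :=
  (dP (d : ℤ) s)⁻¹ • x ∈ M ∧ ∀ d' : ℕ, d' < d → ∀ s' : ZMod k, (dP (d' : ℤ) s')⁻¹ • x ∉ M

/-- `T^{-L} R^s m` is the previous marker before `m`. -/
def IsPrev (M : Set (FreePart (DeltaK k))) (m : FreePart (DeltaK k)) (L : ℕ) (s : ZMod k) : Prop :=
  0 < L ∧ dP (L : ℤ) s • m ∈ M ∧ ∀ L' : ℕ, 0 < L' → L' < L → ∀ s' : ZMod k, dP (L' : ℤ) s' • m ∉ M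

/-- All the data at `x`. -/
def IsData (M : Set (FreePart (DeltaK k))) (x : FreePart (DeltaK k))
    (v : ℕ × ZMod k × ℕ × ZMod k) : Prop :=
  IsNext M x v.1 v.2.1 ∧ IsPrev M ((dP (v.1 : ℤ) v.2.1)⁻¹ • x) v.2.2.1 v.2.2.2

/-- Discreteness with parameter `N`. -/
def Discr (M : Set (FreePart (DeltaK k))) (N : ℕ) : Prop :=
  ∀ x ∈ M, ∀ g : DeltaK k, g • x ∈ M → |dH g| ≤ N → g = 1

/-- Syndeticity with parameter `N`. -/
def Synd (M : Set (FreePart (DeltaK k))) (N : ℕ) : Prop :=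
  ∀ x, ∃ g : DeltaK k, |dH g| ≤ N ∧ g • x ∈ M

theorem exists_discr_synd [NeZero k] (N : ℕ) : ∃ M : Set (FreePart (DeltaK k)),
    MeasurableSet M ∧ Discr M N ∧ Synd M N := by
  obtain ⟨M, h1, h2, h3⟩ := exists_marker {g : DeltaK k | |dH g| ≤ N ∧ g ≠ 1}
    ((heights_finite N).subset fun g hg => hg.1) (fun h => h.2 rfl)
    (fun g hg => ⟨by rw [dH_inv, abs_neg]; exact hg.1, inv_ne_one.2 hg.2⟩)
  refine ⟨M, h1, ?_, ?_⟩
  · intro x hx g hg hN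
    by_contra hne
    exact h2 x hx g ⟨hN, hne⟩ hg
  · intro x
    by_cases hx : x ∈ M
    · exact ⟨1, by simp [dH_one], by simpa using hx⟩
    · obtain ⟨g, hg, hgx⟩ := h3 x hx
      exact ⟨g, hg.1, hgx⟩

variable {M : Set (FreePart (DeltaK k))} {N : ℕ}

theorem exists_isNext (hS : Synd M N) (x : FreePart (DeltaK k)) : ∃ d s, IsNext M x d s := by
  classical
  have h : ∃ d : ℕ, ∃ s : ZMod k, (dP (d : ℤ) s)⁻¹ • x ∈ M := by
    obtain ⟨g, hg, hgx⟩ := hS (dT k N • x)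
    rw [← mul_smul] at hgx
    have hb := abs_le.1 hg
    obtain ⟨s, hs⟩ := exists_dP (g := (g * dT k N)⁻¹) (d := ((dH g + N).toNat : ℤ)) (by
      rw [dH_inv, dH_mul, dH_T, Int.toNat_of_nonneg (by linarith)])
    exact ⟨_, s, by rw [← hs]; simpa using hgx⟩
  obtain ⟨s, hs⟩ := Nat.find_spec h
  exact ⟨Nat.find h, s, hs, fun d' hd s' hm => Nat.find_min h hd ⟨s', hm⟩⟩

theorem exists_isPrev (hS : Synd M N) (x : FreePart (DeltaK k)) : ∃ L s, IsPrev M x L s := by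
  classical
  have h : ∃ L : ℕ, 0 < L ∧ ∃ s : ZMod k, dP (L : ℤ) s • x ∈ M := by
    obtain ⟨g, hg, hgx⟩ := hS (dT k (-(N + 1)) • x)
    rw [← mul_smul] at hgx
    have hb := abs_le.1 hg
    have hnn : (0 : ℤ) < N + 1 - dH g := by linarith
    obtain ⟨s, hs⟩ := exists_dP (g := g * dT k (-(N + 1))) (d := ((N + 1 - dH g).toNat : ℤ)) (by
      rw [dH_mul, dH_T, Int.toNat_of_nonneg hnn.le]; ring)
    exact ⟨(N + 1 - dH g).toNat, by omega, s, by rw [← hs]; exact hgx⟩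
  obtain ⟨h0, s, hs⟩ := Nat.find_spec h
  exact ⟨Nat.find h, s, h0, hs, fun d' h0 hd s' hm => Nat.find_min h hd ⟨h0, s', hm⟩⟩

theorem isNext_unique (hD : Discr M N) {x : FreePart (DeltaK k)} {d d' : ℕ} {s s' : ZMod k}
    (h : IsNext M x d s) (h' : IsNext M x d' s') : d = d' ∧ s = s' := by
  have hd : d = d' := by
    rcases lt_trichotomy d d' with hlt | rfl | hlt
    · exact absurd h.1 (h'.2 d hlt s)
    · rfl
    · exact absurd h'.1 (h.2 d' hlt s')
  subst hd
  refine ⟨rfl, ?_⟩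
  have := hD ((dP (d : ℤ) s)⁻¹ • x) h.1 ((dP (d : ℤ) s')⁻¹ * dP (d : ℤ) s) (by
    rw [mul_smul, smul_inv_smul]; exact h'.1) (by simp [dH_mul, dH_inv, dH_P])
  exact (dP_inj (inv_mul_eq_one.1 this)).symm

theorem isPrev_unique (hD : Discr M N) {x : FreePart (DeltaK k)} {d d' : ℕ} {s s' : ZMod k}
    (h : IsPrev M x d s) (h' : IsPrev M x d' s') : d = d' ∧ s = s' := by
  have hd : d = d' := by
    rcases lt_trichotomy d d' with hlt | rfl | hlt
    · exact absurd h.2.1 (h'.2.2 d h.1 hlt s)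
    · rfl
    · exact absurd h'.2.1 (h.2.2 d' h'.1 hlt s')
  subst hd
  refine ⟨rfl, ?_⟩
  have := hD (dP (d : ℤ) s • x) h.2.1 (dP (d : ℤ) s' * (dP (d : ℤ) s)⁻¹) (by
    rw [mul_smul, inv_smul_smul]; exact h'.2.1) (by simp [dH_mul, dH_inv, dH_P])
  exact (dP_inj (mul_inv_eq_one.1 this)).symm

theorem isData_unique (hD : Discr M N) {x : FreePart (DeltaK k)} {v w : ℕ × ZMod k × ℕ × ZMod k}
    (h : IsData M x v) (h' : IsData M x w) : v = w := by
  obtain ⟨d, s, L, u⟩ := v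
  obtain ⟨d', s', L', u'⟩ := w
  obtain ⟨rfl, rfl⟩ := isNext_unique hD h.1 h'.1
  obtain ⟨rfl, rfl⟩ := isPrev_unique hD h.2 h'.2
  rfl

theorem exists_isData (hS : Synd M N) (x : FreePart (DeltaK k)) : ∃ v, IsData M x v := by
  obtain ⟨d, s, h⟩ := exists_isNext hS x
  obtain ⟨L, u, h'⟩ := exists_isPrev hS ((dP (d : ℤ) s)⁻¹ • x)
  exact ⟨(d, s, L, u), h, h'⟩

theorem measurable_smulSet (hM : MeasurableSet M) (g : DeltaK k) :
    MeasurableSet {x : FreePart (DeltaK k) | g • x ∈ M} :=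
  (continuous_smul_freePart g).measurable hM

theorem measurable_isData [NeZero k] (hM : MeasurableSet M) (v : ℕ × ZMod k × ℕ × ZMod k) :
    MeasurableSet {x | IsData M x v} := by
  have hA : ∀ d s, MeasurableSet {x | IsNext M x d s} := by
    intro d s
    have : {x | IsNext M x d s} = {x | (dP (d : ℤ) s)⁻¹ • x ∈ M} ∩
        ⋂ (d' : ℕ) (_ : d' < d) (s' : ZMod k), {x | (dP (d' : ℤ) s')⁻¹ • x ∈ M}ᶜ := by
      ext x; simp [IsNext]
    rw [this]
    exact (measurable_smulSet hM _).inter <| MeasurableSet.iInter fun _ =>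
      MeasurableSet.iInter fun _ => MeasurableSet.iInter fun _ => (measurable_smulSet hM _).compl
  have hB : ∀ L s, MeasurableSet {x | IsPrev M x L s} := by
    intro L s
    have : {x | IsPrev M x L s} = {_x | 0 < L} ∩ ({x | dP (L : ℤ) s • x ∈ M} ∩
        ⋂ (L' : ℕ) (_ : 0 < L') (_ : L' < L) (s' : ZMod k), {x | dP (L' : ℤ) s' • x ∈ M}ᶜ) := by
      ext x; simp [IsPrev]
    rw [this]
    exact (MeasurableSet.const _).inter <| (measurable_smulSet hM _).inter <|
      MeasurableSet.iInter fun _ => MeasurableSet.iInter fun _ => MeasurableSet.iInter fun _ =>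
      MeasurableSet.iInter fun _ => (measurable_smulSet hM _).compl
  exact (hA _ _).inter ((continuous_smul_freePart _).measurable (hB _ _))

/-- Shifting data: an element of height `e ≤ d` moves `x` along the same interval. -/
theorem isNext_smul {x : FreePart (DeltaK k)} {d d₂ : ℕ} {s s₂ : ZMod k} {g : DeltaK k}
    (h : IsNext M x d s) (hd : d₂ ≤ d) (hg : g * dP (d : ℤ) s = dP (d₂ : ℤ) s₂) :
    IsNext M (g • x) d₂ s₂ ∧ (dP (d₂ : ℤ) s₂)⁻¹ • g • x = (dP (d : ℤ) s)⁻¹ • x := by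
  have e : (dP (d₂ : ℤ) s₂)⁻¹ • g • x = (dP (d : ℤ) s)⁻¹ • x := by
    rw [← hg, ← mul_smul]; group
  refine ⟨⟨e ▸ h.1, ?_⟩, e⟩
  intro d' hd' s' hm
  have hH : dH g = d - d₂ := by
    have := congrArg dH hg
    rw [dH_mul, dH_P, dH_P] at this; linarith
  rw [← mul_smul] at hm
  obtain ⟨u, hu⟩ := exists_dP (g := ((dP (d' : ℤ) s')⁻¹ * g)⁻¹) (d := ((d' + (d - d₂) : ℕ) : ℤ))
    (by rw [dH_inv, dH_mul, dH_inv, dH_P, hH]; push_cast [hd]; ring)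
  refine h.2 (d' + (d - d₂)) (by omega) u ?_
  rw [← hu, inv_inv]; exact hm

theorem upper [NeZero k] : HasBorelColoring (ShiftAdj (TK k)) (k + 1) := by
  classical
  obtain ⟨N, Q, hQ⟩ := exists_seatPaths (ZMod k)
  obtain ⟨M, hM, hD, hS⟩ := exists_discr_synd (k := k) N
  choose F hF using exists_isData hS
  let col : ℕ × ZMod k × ℕ × ZMod k → Option (ZMod k) :=
    fun v => Q (seatTau (v.2.2.1 : ℤ) v.2.2.2) v.1 (some v.2.1)
  have hcol : ∀ {x v}, IsData M x v → col (F x) = col v := fun h => by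
    rw [isData_unique hD (hF _) h]
  have eqv : Option (ZMod k) ≃ Fin (k + 1) := Fintype.equivFinOfCardEq (by simp [ZMod.card])
  let _ : MeasurableSpace (ZMod k) := ⊤
  have hFm : Measurable F := by
    refine measurable_to_countable' fun v => ?_
    have : F ⁻¹' {v} = {x | IsData M x v} := by
      ext x
      constructor
      · intro h
        have h' : F x = v := h
        exact h' ▸ hF x
      · intro h
        exact isData_unique hD (hF x) h
    rw [this]
    exact measurable_isData hM v
  have main1 : ∀ (x : FreePart (DeltaK k)) (i : ZMod k), i ≠ 0 →
      col (F x) ≠ col (F (dR i • x)) := by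
    intro x i hi
    obtain ⟨h1, h2⟩ := hF x
    obtain ⟨s', hne, hs'⟩ := dR_mul_dP hi ((F x).1 : ℤ) (F x).2.1
    obtain ⟨h3, h4⟩ := isNext_smul h1 le_rfl hs'
    have h5 : IsData M (dR i • x) ((F x).1, s', (F x).2.2.1, (F x).2.2.2) :=
      ⟨h3, by rw [h4]; exact h2⟩
    rw [hcol h5]
    exact seatStep_refl _ _ _ hne.symm
  have main2 : ∀ (x : FreePart (DeltaK k)) (i : ZMod k), i ≠ 0 →
      col (F x) ≠ col (F ((dR i * dT k 1) • x)) := by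
    intro x i hi
    obtain ⟨h1, h2⟩ := hF x
    by_cases hd : (F x).1 = 0
    · obtain ⟨h3, h4⟩ := hF ((dR i * dT k 1) • x)
      generalize hx : F x = v at *
      generalize hy : F ((dR i * dT k 1) • x) = w at *
      obtain ⟨d, s, L, u⟩ := v
      obtain ⟨d', s', L', u'⟩ := w
      simp only at hd h1 h2 h3 h4
      subst hd
      obtain ⟨s₂, hs₂⟩ := exists_dP (g := (dR i * dT k 1)⁻¹ * dP (d' : ℤ) s')
        (d := ((d' + 1 : ℕ) : ℤ)) (by
          rw [dH_mul, dH_inv, dH_mul, dH_R, dH_T, dH_P]; push_cast; ring)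
      have hne : s' ≠ s₂ := by
        obtain ⟨s₃, h5, h6⟩ := dR_mul_dP hi (d' : ℤ) s₂
        have h7 : dR i * dP (d' : ℤ) s₂ = dP (d' : ℤ) s' := by
          have : dP (d' : ℤ) s₂ = dT k 1 * dP ((d' + 1 : ℕ) : ℤ) s₂ := by
            rw [dT_mul_dP]; congr 1; push_cast; ring
          rw [this, ← hs₂]; group
        rw [h6] at h7
        rw [← dP_inj h7]; exact h5
      obtain ⟨s₀, hs₀⟩ := exists_dP (g := (dP ((0 : ℕ) : ℤ) s)⁻¹ * dP ((d' + 1 : ℕ) : ℤ) s₂)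
        (d := ((d' + 1 : ℕ) : ℤ)) (by
          rw [dH_mul, dH_inv, dH_P, dH_P]; push_cast; ring)
      have hx0 : dP ((d' + 1 : ℕ) : ℤ) s₀ • (dP (d' : ℤ) s')⁻¹ • (dR i * dT k 1) • x =
          (dP ((0 : ℕ) : ℤ) s)⁻¹ • x := by
        rw [← hs₀, ← hs₂, ← mul_smul, ← mul_smul]; group
      have hP : IsPrev M ((dP (d' : ℤ) s')⁻¹ • (dR i * dT k 1) • x) (d' + 1) s₀ := by
        refine ⟨by omega, by rw [hx0]; exact h1.1, ?_⟩
        intro l hl0 hl a ha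
        rw [← mul_smul] at ha
        obtain ⟨b, hb⟩ := exists_dP (g := (dP (l : ℤ) a * (dP (d' : ℤ) s')⁻¹)⁻¹)
          (d := ((d' - l : ℕ) : ℤ)) (by
            rw [dH_inv, dH_mul, dH_inv, dH_P, dH_P]
            push_cast [show l ≤ d' by omega]; ring)
        refine h3.2 (d' - l) (by omega) b ?_
        rw [← hb, inv_inv]; exact ha
      obtain ⟨rfl, rfl⟩ := isPrev_unique hD h4 hP
      have hN : N ≤ d' + 1 := by
        by_contra hlt
        have h5 := hD _ h3.1 _ hP.2.1 (by
          rw [dH_P, abs_neg, abs_of_nonneg (by positivity)]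
          exact_mod_cast (by omega : d' + 1 ≤ N))
        have h6 := congrArg dH h5
        rw [dH_P, dH_one] at h6
        push_cast at h6
        omega
      have ht : seatTau ((d' + 1 : ℕ) : ℤ) u' (some s₂) = some s := by
        apply seatTau_some
        have h0 : dP ((0 : ℕ) : ℤ) s = dR s := by simp [dP, dT_zero]
        rw [← hs₀, h0]; group
      have hstep := (hQ (seatTau ((d' + 1 : ℕ) : ℤ) u')).2.2 d' s' s₂ hne
      rw [(hQ _).2.1 (d' + 1) hN, ht] at hstep
      simp only [col]
      rw [(hQ _).1]
      exact hstep.symm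
    · obtain ⟨d, hd'⟩ := Nat.exists_eq_succ_of_ne_zero hd
      obtain ⟨s', hne, hs'⟩ := dR_mul_dP hi (d : ℤ) (F x).2.1
      have e : dR i * dT k 1 * dP ((F x).1 : ℤ) (F x).2.1 = dP (d : ℤ) s' := by
        rw [mul_assoc, dT_mul_dP, ← hs', hd']; congr 2; push_cast; ring
      obtain ⟨h3, h4⟩ := isNext_smul h1 (by omega) e
      have h5 : IsData M ((dR i * dT k 1) • x) (d, s', (F x).2.2.1, (F x).2.2.2) :=
        ⟨h3, by rw [h4]; exact h2⟩
      rw [hcol h5]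
      have := (hQ (seatTau ((F x).2.2.1 : ℤ) (F x).2.2.2)).2.2 d s' (F x).2.1 hne
      simp only [col]
      rw [hd']
      exact this.symm
  refine ⟨fun x => eqv (col (F x)), ?_, ?_⟩
  · exact (measurable_of_countable (fun v => eqv (col v))).comp hFm
  · intro x y hxy
    rw [shiftAdj_iff _ one_notMem_TK] at hxy
    obtain ⟨g, hg, rfl⟩ := hxy
    refine fun h => ?_
    have h := eqv.injective h
    rcases mem_TK.1 hg with ⟨i, hi, rfl⟩ | ⟨i, hi, -, rfl⟩ | ⟨i, hi, -, rfl⟩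
    · exact main1 x i hi h
    · exact main2 x i hi h
    · refine main2 ((dR i * dT k (-1)) • x) i hi ?_
      rw [← mul_smul]
      have e : dR i * dT k 1 * (dR i * dT k (-1)) = 1 := by
        rw [mul_assoc, ← mul_assoc (dT k 1), dT_mul_dR, mul_assoc, ← dT_add, ← mul_assoc, ← dR_add]
        simp [dR_zero, dT_zero]
      rw [e, one_smul]; exact h.symm

end Upper

section Lower

variable {k : ℕ}

theorem zmod_const [NeZero k] (P : ZMod k → Prop) (h : ∀ b, P b → P (b + 1)) {a : ZMod k}
    (ha : P a) (b : ZMod k) : P b := by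
  have : ∀ n : ℕ, P (a + n) := by
    intro n
    induction n with
    | zero => simpa using ha
    | succ n ih => rw [Nat.cast_succ, ← add_assoc]; exact h _ ih
  have h2 := this (b - a).val
  rwa [ZMod.natCast_zmod_val, add_sub_cancel] at h2

theorem layer_transition [NeZero k] (c : FreePart (DeltaK k) → Fin k)
    (hc : ∀ x y, ShiftAdj (TK k) x y → c x ≠ c y) (x : FreePart (DeltaK k)) :
    Function.Bijective (fun i : ZMod k => c (dR i • x)) ∧
    ∃ e : ZMod k, ∀ b : ZMod k, c (dR b • dT k 1 • x) = c (dR (e - b) • x) := by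
  classical
  have hc' : ∀ (x : FreePart (DeltaK k)) (g : DeltaK k), g ∈ TK k → c x ≠ c (g • x) :=
    fun x g hg => hc _ _ ((shiftAdj_iff _ one_notMem_TK _ _).2 ⟨g, hg, rfl⟩)
  have hinj : ∀ x : FreePart (DeltaK k), Function.Injective (fun i : ZMod k => c (dR i • x)) := by
    intro x i j hij
    by_contra hne
    refine hc' (dR i • x) (dR (j - i)) (mem_TK.2 (Or.inl ⟨_, sub_ne_zero.2 (Ne.symm hne), rfl⟩)) ?_
    rw [← mul_smul, ← dR_add, sub_add_cancel]; exact hij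
  have hbij : ∀ x : FreePart (DeltaK k), Function.Bijective (fun i : ZMod k => c (dR i • x)) :=
    fun x => (Fintype.bijective_iff_injective_and_card _).2 ⟨hinj x, by simp [ZMod.card]⟩
  refine ⟨hbij x, ?_⟩
  have hex : ∀ b : ZMod k, ∃ e : ZMod k, (e = 0 ∨ e = 1) ∧
      c (dR b • dT k 1 • x) = c (dR (e - b) • x) := by
    intro b
    obtain ⟨a, ha⟩ := (hbij x).2 (c (dR b • dT k 1 • x))
    refine ⟨a + b, ?_, by rw [add_sub_cancel_right]; exact ha.symm⟩
    by_contra hcon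
    push Not at hcon
    refine hc' (dR a • x) (dR (a + b) * dT k 1)
      (mem_TK.2 (Or.inr (Or.inl ⟨_, hcon.1, hcon.2, rfl⟩))) ?_
    have : dR (a + b) * dT k 1 * dR a = dR b * dT k 1 := by
      rw [mul_assoc, dT_mul_dR, ← mul_assoc, ← dR_add]; congr 2; ring
    rw [← mul_smul, this, mul_smul]; exact ha
  choose e he1 he2 using hex
  by_cases h0 : ∃ b, e b = 0
  · obtain ⟨a, ha⟩ := h0
    have hall := zmod_const (fun b => e b = 0) (fun b hb => by
      rcases he1 (b + 1) with h | h
      · exact h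
      · have h1 := he2 b
        have h2 := he2 (b + 1)
        rw [h, show (1 : ZMod k) - (b + 1) = 0 - b by ring] at h2
        rw [hb, ← h2] at h1
        have h3 := hinj (dT k 1 • x) h1
        have h10 : (1 : ZMod k) = 0 := by
          have : b + 0 = b + 1 := by simpa using h3
          exact (add_left_cancel this).symm
        exact h.trans h10) ha
    exact ⟨0, fun b => by rw [he2 b, hall b]⟩
  · push Not at h0
    exact ⟨1, fun b => by rw [he2 b, (he1 b).resolve_left (h0 b)]⟩

theorem lower (hk : 3 ≤ k) : ¬ HasBorelColoring (ShiftAdj (TK k)) k := by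
  rintro ⟨c, hcm, hc⟩
  have : NeZero k := ⟨by omega⟩
  let B : Set (FreePart (DeltaK k)) :=
    {x | ∃ i : ZMod k, c (dR i • x) = 0 ∧ c (dR (i + 1) • x) < c (dR (i - 1) • x)}
  have hBm : MeasurableSet B := by
    have : B = ⋃ i : ZMod k, {x | c (dR i • x) = 0} ∩
        {x | c (dR (i + 1) • x) < c (dR (i - 1) • x)} := by
      ext x; simp [B]
    rw [this]
    have hm : ∀ g : DeltaK k, Measurable fun x => c (g • x) := fun g =>
      hcm.comp (continuous_smul_freePart g).measurable
    exact MeasurableSet.iUnion fun i =>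
      ((hm _) (measurableSet_singleton 0)).inter (measurableSet_lt (hm _) (hm _))
  refine no_swap_set (dT k 1) ?_ B hBm ?_
  · intro I
    obtain ⟨K, hK⟩ : ∃ K : ℕ, ∀ h ∈ I, |dH h| ≤ K := by
      refine ⟨I.sup fun h => (dH h).natAbs, fun h hh => ?_⟩
      have := Finset.le_sup (f := fun h : DeltaK k => (dH h).natAbs) hh
      rw [Int.abs_eq_natAbs]
      exact_mod_cast this
    refine ⟨2 * K + 1, ⟨K, rfl⟩, fun h hh hm => ?_⟩
    have h1 := hK _ hh
    have h2 := hK _ hm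
    have hp : ∀ n : ℕ, dH (dT k 1 ^ n) = n := by
      intro n
      induction n with
      | zero => simp [dH_one]
      | succ n ih => rw [pow_succ, dH_mul, ih, dH_T]; push_cast; ring
    rw [dH_mul, dH_inv, hp] at h2
    rw [abs_le] at h1 h2
    push_cast at h2
    omega
  · intro x
    obtain ⟨hb, e, he⟩ := layer_transition c hc x
    obtain ⟨i, hi⟩ := hb.2 0
    have hi : c (dR i • x) = 0 := hi
    have hne : c (dR (i + 1) • x) ≠ c (dR (i - 1) • x) := by
      intro h
      have h1 : i + 1 = i - 1 := hb.1 h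
      have h2 : ((2 : ℕ) : ZMod k) = 0 := by
        have : (2 : ZMod k) = (i + 1) - (i - 1) := by ring
        push_cast
        rw [this, h1, sub_self]
      rw [ZMod.natCast_eq_zero_iff] at h2
      have := Nat.le_of_dvd (by norm_num) h2
      omega
    have hx : x ∈ B ↔ c (dR (i + 1) • x) < c (dR (i - 1) • x) := by
      constructor
      · rintro ⟨j, hj, h⟩
        have : j = i := hb.1 (hj.trans hi.symm)
        rwa [this] at h
      · exact fun h => ⟨i, hi, h⟩
    have hy : dT k 1 • x ∈ B ↔ c (dR (i - 1) • x) < c (dR (i + 1) • x) := by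
      constructor
      · rintro ⟨j, hj, h⟩
        rw [he] at hj
        have hji : e - j = i := hb.1 (hj.trans hi.symm)
        rw [he, he] at h
        rwa [show e - (j + 1) = i - 1 by rw [← hji]; ring,
          show e - (j - 1) = i + 1 by rw [← hji]; ring] at h
      · intro h
        refine ⟨e - i, ?_, ?_⟩
        · rw [he, sub_sub_cancel]; exact hi
        · rw [he, he]
          rwa [show e - (e - i + 1) = i - 1 by ring, show e - (e - i - 1) = i + 1 by ring]
    rw [hx, hy, not_lt]
    exact ⟨le_of_lt, fun h => lt_of_le_of_ne h hne.symm⟩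

end Lower

/-- For `k ≥ 3`, the Borel chromatic number of the shift graph of
`(Δ_k, T_k)` equals `k + 1`. -/
theorem borelChromatic_shift_DeltaK (k : ℕ) (hk : 3 ≤ k) :
    borelChromatic (ShiftAdj (TK k)) = k + 1 := by
  have : NeZero k := ⟨by omega⟩
  refine le_antisymm (Nat.sInf_le upper) ?_
  have hmem : HasBorelColoring (ShiftAdj (TK k)) (borelChromatic (ShiftAdj (TK k))) :=
    Nat.sInf_mem (s := {n | HasBorelColoring (ShiftAdj (TK k)) n}) ⟨k + 1, upper⟩
  by_contra hlt
  obtain ⟨c, hcm, hc⟩ := hmem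
  have hle : borelChromatic (ShiftAdj (TK k)) ≤ k := by omega
  refine lower hk ⟨fun x => Fin.castLE hle (c x), ?_, ?_⟩
  · exact (measurable_of_countable (Fin.castLE hle)).comp hcm
  · intro x y hxy h
    exact hc x y hxy (Fin.castLE_injective hle h)
end

section
/- Fix k ≥ 3. Let Γ_k = (ℤ/kℤ) × ℤ with generating set S_k = {(i,0) : i ≠ 0} ∪ {(i,1) : i ≠ 0,1} ∪ {(-i,-1) : i ≠ 0,1}, and let Δ_k = (ℤ/kℤ) ⋊_φ ℤ (φ sending 1 to inversion) with generating set T_k = {(i,0) : i ≠ 0} ∪ {(i,1) : i ≠ 0,1} ∪ {(i,-1) : i ≠ 0,1}. Then the Cayley graphs Cay(Γ_k,S_k) and Cay(Δ_k,T_k) are isomorphic as graphs, and both have chromatic number k. -/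
open Multiplicative

/-- The marked group `Γ_k = ℤ/kℤ × ℤ` (written multiplicatively). -/
abbrev GammaK (k : ℕ) : Type := Multiplicative (ZMod k × ℤ)

/-- The generating set
`S_k = {(i,0) : i ≠ 0} ∪ {(i,1) : i ≠ 0,1} ∪ {(-i,-1) : i ≠ 0,1}` of `Γ_k`. -/
def SK (k : ℕ) : Set (GammaK k) :=
  {x | ∃ i : ZMod k, i ≠ 0 ∧ x = ofAdd (i, (0 : ℤ))} ∪
  {x | ∃ i : ZMod k, i ≠ 0 ∧ i ≠ 1 ∧ x = ofAdd (i, (1 : ℤ))} ∪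
  {x | ∃ i : ZMod k, i ≠ 0 ∧ i ≠ 1 ∧ x = ofAdd (-i, (-1 : ℤ))}

lemma gamma_adj_iff (k : ℕ) (g h : GammaK k) : CayleyAdj (SK k) g h ↔
    ((toAdd h).2 = (toAdd g).2 ∧ (toAdd h).1 ≠ (toAdd g).1) ∨
    ((toAdd h).2 = (toAdd g).2 + 1 ∧ (toAdd h).1 - (toAdd g).1 ≠ 0 ∧
      (toAdd h).1 - (toAdd g).1 ≠ 1) ∨
    ((toAdd g).2 = (toAdd h).2 + 1 ∧ (toAdd g).1 - (toAdd h).1 ≠ 0 ∧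
      (toAdd g).1 - (toAdd h).1 ≠ 1) := by
  obtain ⟨⟨a, n⟩, rfl⟩ := ofAdd.surjective g
  obtain ⟨⟨b, m⟩, rfl⟩ := ofAdd.surjective h
  simp only [toAdd_ofAdd]
  constructor
  · rintro ⟨hne, s, ((⟨i, hi, rfl⟩ | ⟨i, hi, hi1, rfl⟩) | ⟨i, hi, hi1, rfl⟩), he⟩ <;>
    · rw [← ofAdd_add] at he
      have he := ofAdd.injective he
      simp only [Prod.mk_add_mk, Prod.mk.injEq] at he
      obtain ⟨rfl, rfl⟩ := he
      simp [hi]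
      try simp [hi1, add_comm]
  · rintro (⟨rfl, h1⟩ | ⟨rfl, h1, h2⟩ | ⟨rfl, h1, h2⟩)
    · refine ⟨fun h => h1 ?_, ofAdd (b - a, 0), Or.inl (Or.inl ⟨b - a, sub_ne_zero.2 h1, rfl⟩), ?_⟩
      · exact (congrArg Prod.fst (ofAdd.injective h)).symm
      · rw [← ofAdd_add]; simp
    · refine ⟨fun h => ?_, ofAdd (b - a, 1), Or.inl (Or.inr ⟨b - a, h1, h2, rfl⟩), ?_⟩
      · have := congrArg Prod.snd (ofAdd.injective h)
        simp at this
      · rw [← ofAdd_add]; simp [add_comm]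
    · refine ⟨fun h => ?_, ofAdd (-(a - b), -1), Or.inr ⟨a - b, h1, h2, rfl⟩, ?_⟩
      · have := congrArg Prod.snd (ofAdd.injective h)
        simp at this
      · rw [← ofAdd_add]; simp

lemma phiK_one (k : ℕ) (x : ZMod k) : phiK k (ofAdd 1) (ofAdd x) = ofAdd (-x) := by
  simp [phiK]

lemma phiK_neg_one (k : ℕ) (x : ZMod k) : phiK k (ofAdd (-1)) (ofAdd x) = ofAdd (-x) := by
  rw [ofAdd_neg, map_inv, MulAut.inv_apply, MulEquiv.symm_apply_eq, phiK_one, neg_neg]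

lemma delta_adj_iff (k : ℕ) (a b : ZMod k) (n m : ℤ) :
    CayleyAdj (TK k) ⟨ofAdd a, ofAdd n⟩ ⟨ofAdd b, ofAdd m⟩ ↔
    (m = n ∧ b ≠ a) ∨
    (m = n + 1 ∧ b + a ≠ 0 ∧ b + a ≠ 1) ∨
    (n = m + 1 ∧ b + a ≠ 0 ∧ b + a ≠ 1) := by
  have hmk : ∀ (i j : ZMod k) (p q : ℤ),
      ((⟨ofAdd i, ofAdd p⟩ : DeltaK k) = ⟨ofAdd j, ofAdd q⟩) ↔ i = j ∧ p = q := by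
    intro i j p q
    simp [SemidirectProduct.ext_iff]
  have m0 : ∀ i, (⟨ofAdd i, ofAdd 0⟩ : DeltaK k) * ⟨ofAdd a, ofAdd n⟩ =
      ⟨ofAdd (i + a), ofAdd n⟩ := by
    intro i
    ext <;> simp
  have m1 : ∀ i, (⟨ofAdd i, ofAdd 1⟩ : DeltaK k) * ⟨ofAdd a, ofAdd n⟩ =
      ⟨ofAdd (i - a), ofAdd (n + 1)⟩ := by
    intro i
    ext
    · simp only [SemidirectProduct.mul_left, phiK_one, ← ofAdd_add, sub_eq_add_neg]
    · simp only [SemidirectProduct.mul_right, ← ofAdd_add, add_comm]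
  have m2 : ∀ i, (⟨ofAdd i, ofAdd (-1)⟩ : DeltaK k) * ⟨ofAdd a, ofAdd n⟩ =
      ⟨ofAdd (i - a), ofAdd (n - 1)⟩ := by
    intro i
    ext
    · simp only [SemidirectProduct.mul_left, phiK_neg_one, ← ofAdd_add, sub_eq_add_neg]
    · simp only [SemidirectProduct.mul_right, ← ofAdd_add, add_comm, sub_eq_add_neg]
  constructor
  · rintro ⟨hne, s, ((⟨i, hi, rfl⟩ | ⟨i, hi, hi1, rfl⟩) | ⟨i, hi, hi1, rfl⟩), he⟩
    · rw [m0, hmk] at he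
      obtain ⟨rfl, rfl⟩ := he
      simp [hi]
    · rw [m1, hmk] at he
      obtain ⟨rfl, rfl⟩ := he
      simp [hi, hi1]
    · rw [m2, hmk] at he
      obtain ⟨rfl, rfl⟩ := he
      simp [hi, hi1]
  · rintro (⟨rfl, h1⟩ | ⟨rfl, h1, h2⟩ | ⟨rfl, h1, h2⟩)
    · refine ⟨fun h => h1 ((hmk _ _ _ _).1 h).1.symm, _,
        Or.inl (Or.inl ⟨b - a, sub_ne_zero.2 h1, rfl⟩), ?_⟩
      rw [m0, hmk]; simp
    · refine ⟨fun h => ?_, _, Or.inl (Or.inr ⟨b + a, h1, h2, rfl⟩), ?_⟩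
      · have := ((hmk _ _ _ _).1 h).2
        omega
      · rw [m1, hmk]; simp
    · refine ⟨fun h => ?_, _, Or.inr ⟨b + a, h1, h2, rfl⟩, ?_⟩
      · have := ((hmk _ _ _ _).1 h).2
        omega
      · rw [m2, hmk]; simp

/-- The fibrewise map: `a ↦ -a + m` on level `2m` and `a ↦ a - m` on level `2m+1`. -/
def fibMap (k : ℕ) (n : ℤ) (a : ZMod k) : ZMod k :=
  if n % 2 = 0 then -a + ((n / 2 : ℤ) : ZMod k) else a - ((n / 2 : ℤ) : ZMod k)

/-- Inverse of `fibMap`. -/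
def fibInv (k : ℕ) (n : ℤ) (a : ZMod k) : ZMod k :=
  if n % 2 = 0 then -a + ((n / 2 : ℤ) : ZMod k) else a + ((n / 2 : ℤ) : ZMod k)

lemma fibInv_fibMap (k : ℕ) (n : ℤ) (a : ZMod k) : fibInv k n (fibMap k n a) = a := by
  unfold fibInv fibMap; split_ifs <;> ring

lemma fibMap_fibInv (k : ℕ) (n : ℤ) (a : ZMod k) : fibMap k n (fibInv k n a) = a := by
  unfold fibInv fibMap; split_ifs <;> ring

/-- Consecutive levels: the sum is either `b - a` or `1 - (b - a)`. -/
lemma fibMap_succ (k : ℕ) (n : ℤ) (a b : ZMod k) :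
    fibMap k (n + 1) b + fibMap k n a = b - a ∨
    fibMap k (n + 1) b + fibMap k n a = 1 - (b - a) := by
  unfold fibMap
  rcases Int.emod_two_eq_zero_or_one n with h | h
  · left
    rw [if_neg (by omega), if_pos h, show (n + 1) / 2 = n / 2 by omega]
    ring
  · right
    rw [if_pos (by omega), if_neg (by omega), show (n + 1) / 2 = n / 2 + 1 by omega]
    push_cast
    ring

lemma fibMap_succ_iff (k : ℕ) (n : ℤ) (a b : ZMod k) :
    (b - a ≠ 0 ∧ b - a ≠ 1) ↔
    (fibMap k (n + 1) b + fibMap k n a ≠ 0 ∧ fibMap k (n + 1) b + fibMap k n a ≠ 1) := by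
  rcases fibMap_succ k n a b with h | h <;> rw [h]
  generalize b - a = c
  have h1 : 1 - c = 0 ↔ c = 1 := by rw [sub_eq_zero, eq_comm]
  have h2 : 1 - c = 1 ↔ c = 0 := by simp
  simp only [ne_eq, h1, h2, and_comm]

/-- The graph isomorphism. -/
def isoK (k : ℕ) : GammaK k ≃ DeltaK k where
  toFun g := ⟨ofAdd (fibMap k (toAdd g).2 (toAdd g).1), ofAdd (toAdd g).2⟩
  invFun d := ofAdd (fibInv k (toAdd d.right) (toAdd d.left), toAdd d.right)
  left_inv g := by simp [fibInv_fibMap]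
  right_inv d := by ext <;> simp [fibMap_fibInv]

lemma isoK_adj (k : ℕ) (g h : GammaK k) :
    CayleyAdj (SK k) g h ↔ CayleyAdj (TK k) (isoK k g) (isoK k h) := by
  rw [gamma_adj_iff]
  change _ ↔ CayleyAdj (TK k) ⟨ofAdd _, ofAdd _⟩ ⟨ofAdd _, ofAdd _⟩
  rw [delta_adj_iff]
  obtain ⟨a, n⟩ := toAdd g
  obtain ⟨b, m⟩ := toAdd h
  simp only
  refine or_congr (and_congr_right ?_) (or_congr (and_congr_right ?_) (and_congr_right ?_))
  · rintro rfl
    exact not_congr (Function.LeftInverse.injective (fibInv_fibMap k m)).eq_iff.symm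
  · rintro rfl
    exact fibMap_succ_iff k n a b
  · rintro rfl
    rw [add_comm (fibMap k m b)]
    exact fibMap_succ_iff k m b a

lemma hasColoring_gamma (k : ℕ) (hk : 3 ≤ k) : HasColoring (CayleyAdj (SK k)) k := by
  have : NeZero k := ⟨by omega⟩
  refine ⟨fun g => (ZMod.finEquiv k).symm (toAdd g).1, fun g h hgh he => ?_⟩
  have he := (ZMod.finEquiv k).symm.injective he
  rw [gamma_adj_iff, he] at hgh
  simp at hgh

lemma le_of_hasColoring_gamma (k : ℕ) (hk : 3 ≤ k) (n : ℕ)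
    (hc : HasColoring (CayleyAdj (SK k)) n) : k ≤ n := by
  have : NeZero k := ⟨by omega⟩
  obtain ⟨c, hc⟩ := hc
  have hinj : Function.Injective (fun a : ZMod k => c (ofAdd (a, 0))) := by
    intro a b hab
    by_contra hne
    refine hc _ _ ?_ hab
    rw [gamma_adj_iff]
    exact Or.inl ⟨rfl, fun h => hne h.symm⟩
  have := Fintype.card_le_of_injective _ hinj
  simpa [ZMod.card] using this

lemma chromatic_gamma (k : ℕ) (hk : 3 ≤ k) : chromatic (CayleyAdj (SK k)) = k :=
  le_antisymm (Nat.sInf_le (hasColoring_gamma k hk))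
    (le_csInf ⟨k, hasColoring_gamma k hk⟩ fun n hn => le_of_hasColoring_gamma k hk n hn)

lemma hasColoring_iff (k n : ℕ) :
    HasColoring (CayleyAdj (TK k)) n ↔ HasColoring (CayleyAdj (SK k)) n := by
  constructor
  · rintro ⟨c, hc⟩
    exact ⟨fun g => c (isoK k g), fun x y hxy => hc _ _ ((isoK_adj k x y).1 hxy)⟩
  · rintro ⟨c, hc⟩
    refine ⟨fun g => c ((isoK k).symm g), fun x y hxy => hc _ _ ((isoK_adj k _ _).2 ?_)⟩
    simpa using hxy

theorem cayley_iso_and_chromatic (k : ℕ) (hk : 3 ≤ k) :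
    (∃ e : GammaK k ≃ DeltaK k,
      ∀ g h : GammaK k, CayleyAdj (SK k) g h ↔ CayleyAdj (TK k) (e g) (e h)) ∧
    chromatic (CayleyAdj (SK k)) = k ∧ chromatic (CayleyAdj (TK k)) = k := by
  refine ⟨⟨isoK k, isoK_adj k⟩, chromatic_gamma k hk, ?_⟩
  refine Eq.trans ?_ (chromatic_gamma k hk)
  unfold chromatic
  simp only [hasColoring_iff]
end

section
/- Fix k ≥ 3. Let Γ'_k = ℤ with generating set S'_k = {n ∈ ℤ : 2 ≤ |n| ≤ 2k-3}. Then the Borel chromatic number of the shift graph of (Γ'_k,S'_k) equals k. -/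
open Multiplicative

/-- The generating set `S'_k = {n : 2 ≤ |n| ≤ 2k - 3}` of `ℤ` (written multiplicatively). -/
def SK' (k : ℕ) : Set (Multiplicative ℤ) :=
  {x | 2 ≤ |toAdd x| ∧ |toAdd x| ≤ 2 * (k : ℤ) - 3}


theorem aux_marker {X : Type*} [MeasurableSpace X] (T : ℤ → X → X)
    (h0 : ∀ x, T 0 x = x) (hadd : ∀ m n x, T (m + n) x = T m (T n x))
    (hm : ∀ n, Measurable (T n)) (N : ℤ) (U : ℕ → Set X) (hU : ∀ i, MeasurableSet (U i))
    (hcov : ∀ x, ∃ i, x ∈ U i)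
    (hdis : ∀ i x j, 1 ≤ |j| → |j| ≤ N → x ∈ U i → T j x ∉ U i) :
    ∃ M : Set X, MeasurableSet M ∧
      (∀ x j, 1 ≤ |j| → |j| ≤ N → x ∈ M → T j x ∉ M) ∧
      (∀ x, ∃ j : ℤ, (|j| ≤ N ∨ j = 0) ∧ T j x ∈ M) := by
  let P : ℕ → Set X := fun n => Nat.rec ∅
    (fun i S => S ∪ {x | x ∈ U i ∧ ∀ j : ℤ, |j| ≤ N → T j x ∉ S}) n
  have hP0 : P 0 = ∅ := rfl
  have hPs : ∀ i, P (i + 1) = P i ∪ {x | x ∈ U i ∧ ∀ j : ℤ, |j| ≤ N → T j x ∉ P i} :=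
    fun i => rfl
  have hmeas : ∀ i, MeasurableSet (P i) := by
    intro i
    induction i with
    | zero => rw [hP0]; exact MeasurableSet.empty
    | succ i ih =>
      rw [hPs]
      refine ih.union ((hU i).inter ?_)
      have : {x | ∀ j : ℤ, |j| ≤ N → T j x ∉ P i} =
          ⋂ j : ℤ, ⋂ (_ : |j| ≤ N), (T j ⁻¹' (P i))ᶜ := by
        ext x; simp
      change MeasurableSet {x | ∀ j : ℤ, |j| ≤ N → T j x ∉ P i}
      rw [this]
      exact MeasurableSet.iInter fun j => MeasurableSet.iInter fun _ => (hm j ih).compl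
  have hmono : Monotone P := monotone_nat_of_le_succ fun i => by
    rw [hPs]; exact Set.subset_union_left
  have hd : ∀ n x j, 1 ≤ |j| → |j| ≤ N → x ∈ P n → T j x ∉ P n := by
    intro n
    induction n with
    | zero => intro x j _ _ hx; rw [hP0] at hx; exact hx.elim
    | succ n ih =>
      intro x j h1 h2 hx hy
      rw [hPs] at hx hy
      rcases hx with hx | hx <;> rcases hy with hy | hy
      · exact ih x j h1 h2 hx hy
      · refine hy.2 (-j) (by rwa [abs_neg]) ?_
        rw [← hadd, neg_add_cancel, h0]; exact hx
      · exact hx.2 j h2 hy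
      · exact hdis n x j h1 h2 hx.1 hy.1
  refine ⟨⋃ i, P i, MeasurableSet.iUnion hmeas, ?_, ?_⟩
  · intro x j h1 h2 hx hy
    obtain ⟨a, ha⟩ := Set.mem_iUnion.1 hx
    obtain ⟨b, hb⟩ := Set.mem_iUnion.1 hy
    exact hd (max a b) x j h1 h2 (hmono (le_max_left _ _) ha) (hmono (le_max_right _ _) hb)
  · intro x
    obtain ⟨i, hi⟩ := hcov x
    rcases Classical.em (∃ j : ℤ, |j| ≤ N ∧ T j x ∈ P i) with h | h
    · obtain ⟨j, hj, hx⟩ := h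
      exact ⟨j, Or.inl hj, Set.mem_iUnion.2 ⟨i, hx⟩⟩
    · push Not at h
      refine ⟨0, Or.inr rfl, Set.mem_iUnion.2 ⟨i + 1, ?_⟩⟩
      rw [h0, hPs]
      exact Or.inr ⟨hi, h⟩

theorem aux_mod_step (m p s : ℕ) (hm : 0 < m) :
    p % m + s = (p + s) % m ∨ m + (p + s) % m ≤ s + p % m := by
  have h1 := Nat.div_add_mod p m
  have h2 := Nat.div_add_mod (p + s) m
  have h3 : p / m ≤ (p + s) / m := Nat.div_le_div_right (by omega)
  rcases h3.eq_or_lt with h | h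
  · left; rw [← h] at h2; omega
  · right
    have : m * (p / m + 1) ≤ m * ((p + s) / m) := Nat.mul_le_mul_left _ h
    rw [mul_add] at this
    omega

theorem aux_mod_end (m p R : ℕ) (hR : m ∣ R) (hp : p < R) : m + p ≤ R + p % m := by
  obtain ⟨r, rfl⟩ := hR
  have h1 := Nat.div_add_mod p m
  have h : p / m < r := Nat.div_lt_of_lt_mul hp
  have : m * (p / m + 1) ≤ m * r := Nat.mul_le_mul_left _ h
  rw [mul_add] at this
  omega

/-- length of the first part of a gap of length `L` -/
def auxR (k L : ℕ) : ℕ := 2 * k * (L % (2 * k - 1))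

/-- tile length at position `p` in a gap of length `L` -/
def auxE (k L p : ℕ) : ℕ := if p < auxR k L then 2 * k else 2 * k - 1

/-- offset in the tile at position `p` in a gap of length `L` -/
def auxD (k L p : ℕ) : ℕ :=
  if p < auxR k L then p % (2 * k) else (p - auxR k L) % (2 * k - 1)

theorem auxD_lt (k L p : ℕ) (hk : 3 ≤ k) : auxD k L p < auxE k L p := by
  unfold auxD auxE
  split_ifs
  · exact Nat.mod_lt _ (by omega)
  · exact Nat.mod_lt _ (by omega)

theorem auxD_le (k L p : ℕ) : auxD k L p ≤ p := by
  unfold auxD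
  split_ifs
  · exact Nat.mod_le _ _
  · exact (Nat.mod_le _ _).trans (Nat.sub_le _ _)

theorem auxR_le (k L : ℕ) (hk : 3 ≤ k) (hL : 4 * k * k ≤ L) : auxR k L ≤ L := by
  have h : L % (2 * k - 1) ≤ 2 * k := (Nat.mod_lt _ (by omega)).le.trans (by omega)
  unfold auxR
  have := Nat.mul_le_mul_left (2 * k) h
  nlinarith

theorem auxR_dvd (k L : ℕ) (hk : 3 ≤ k) (hL : 4 * k * k ≤ L) : 2 * k - 1 ∣ L - auxR k L := by
  have h1 := Nat.div_add_mod L (2 * k - 1)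
  have h2 := auxR_le k L hk hL
  have h3 : auxR k L = (2 * k - 1) * (L % (2 * k - 1)) + L % (2 * k - 1) := by
    unfold auxR
    obtain ⟨m, hm⟩ : ∃ m, 2 * k = m + 1 := ⟨2 * k - 1, by omega⟩
    rw [hm, Nat.add_sub_cancel]; ring
  have h4 : L - auxR k L = (2 * k - 1) * (L / (2 * k - 1)) - (2 * k - 1) * (L % (2 * k - 1)) := by
    omega
  rw [h4]
  exact Nat.dvd_sub (dvd_mul_right _ _) (dvd_mul_right _ _)

theorem aux_same (k L p s : ℕ) (hk : 3 ≤ k) :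
    auxD k L (p + s) = auxD k L p + s ∨ auxE k L p + auxD k L (p + s) ≤ s + auxD k L p := by
  by_cases h1 : p < auxR k L
  · by_cases h2 : p + s < auxR k L
    · simp only [auxD, auxE, h1, h2, if_true]
      rcases aux_mod_step (2 * k) p s (by omega) with h | h
      · left; omega
      · right; omega
    · right
      have := aux_mod_end (2 * k) p (auxR k L) (dvd_mul_right _ _) h1
      simp only [auxD, auxE, h1, h2, if_true, if_false]
      have := Nat.mod_le (p + s - auxR k L) (2 * k - 1)
      omega
  · have h2 : ¬ p + s < auxR k L := by omega
    simp only [auxD, auxE, h1, h2, if_false]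
    have e : p + s - auxR k L = p - auxR k L + s := by omega
    rw [e]
    rcases aux_mod_step (2 * k - 1) (p - auxR k L) s (by omega) with h | h
    · left; omega
    · right; omega

theorem aux_end (k L p : ℕ) (hk : 3 ≤ k) (hL : 4 * k * k ≤ L) (hp : p < L) :
    auxE k L p + p ≤ L + auxD k L p := by
  have hR := auxR_le k L hk hL
  by_cases h1 : p < auxR k L
  · have := aux_mod_end (2 * k) p (auxR k L) (dvd_mul_right _ _) h1
    simp only [auxD, auxE, h1, if_true]
    omega
  · have := aux_mod_end (2 * k - 1) (p - auxR k L) (L - auxR k L) (auxR_dvd k L hk hL) (by omega)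
    simp only [auxD, auxE, h1, if_false]
    omega

theorem aux_color (k d d' e s : ℕ) (hk : 3 ≤ k) (he : e = 2 * k ∨ e = 2 * k - 1)
    (hs : 2 ≤ s) (hs' : s ≤ 2 * k - 3) (h : d' = d + s ∨ e + d' ≤ s + d) : d' / 2 ≠ d / 2 := by
  omega

theorem auxE_eq (k L p : ℕ) : auxE k L p = 2 * k ∨ auxE k L p = 2 * k - 1 := by
  unfold auxE; split_ifs <;> simp

theorem aux_main {X : Type*} [MeasurableSpace X] (T : ℤ → X → X)
    (h0 : ∀ x, T 0 x = x) (hadd : ∀ m n x, T (m + n) x = T m (T n x))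
    (hm : ∀ n, Measurable (T n)) (k : ℕ) (hk : 3 ≤ k) (M : Set X) (hM : MeasurableSet M)
    (hdis : ∀ x j, 1 ≤ |j| → |j| ≤ ((4 * k * k : ℕ) : ℤ) → x ∈ M → T j x ∉ M)
    (hmax : ∀ x, ∃ j, |j| ≤ ((4 * k * k : ℕ) : ℤ) ∧ T j x ∈ M) :
    ∃ c : X → Fin k, Measurable c ∧
      ∀ x (s : ℕ), 2 ≤ s → s ≤ 2 * k - 3 → c (T s x) ≠ c x := by
  classical
  have hex1 : ∀ x, ∃ p : ℕ, T (-(p : ℤ)) x ∈ M := by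
    intro x
    obtain ⟨j, hj, hx⟩ := hmax (T (-((4 * k * k : ℕ) : ℤ)) x)
    rw [← hadd] at hx
    have := abs_le.1 hj
    refine ⟨(-(j + -((4 * k * k : ℕ) : ℤ))).toNat, ?_⟩
    rw [Int.toNat_of_nonneg (by omega), neg_neg]
    exact hx
  have hex2 : ∀ x, ∃ q : ℕ, 1 ≤ q ∧ T (q : ℤ) x ∈ M := by
    intro x
    obtain ⟨j, hj, hx⟩ := hmax (T (((4 * k * k : ℕ) : ℤ) + 1) x)
    rw [← hadd] at hx
    have := abs_le.1 hj
    refine ⟨(j + (((4 * k * k : ℕ) : ℤ) + 1)).toNat, by omega, ?_⟩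
    rw [Int.toNat_of_nonneg (by omega)]
    exact hx
  have mp : Measurable fun x => Nat.find (hex1 x) :=
    measurable_find hex1 fun n => hm _ hM
  have mq : Measurable fun x => Nat.find (hex2 x) :=
    measurable_find hex2 fun n => by
      by_cases h : 1 ≤ n
      · simp only [h, true_and]; exact hm _ hM
      · simp only [h, false_and]; simp
  have hp : ∀ x, T (-((Nat.find (hex1 x) : ℕ) : ℤ)) x ∈ M := fun x => Nat.find_spec (hex1 x)
  have hp' : ∀ x (n : ℕ), T (-(n : ℤ)) x ∈ M → Nat.find (hex1 x) ≤ n :=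
    fun x n h => Nat.find_min' (hex1 x) h
  have hq : ∀ x, 1 ≤ Nat.find (hex2 x) ∧ T ((Nat.find (hex2 x) : ℕ) : ℤ) x ∈ M :=
    fun x => Nat.find_spec (hex2 x)
  have hq' : ∀ x (n : ℕ), 1 ≤ n → T (n : ℤ) x ∈ M → Nat.find (hex2 x) ≤ n :=
    fun x n h1 h => Nat.find_min' (hex2 x) ⟨h1, h⟩
  generalize hpe : (fun x => Nat.find (hex1 x)) = p at mp
  generalize hqe : (fun x => Nat.find (hex2 x)) = q at mq
  have hpe' : ∀ x, Nat.find (hex1 x) = p x := fun x => congrFun hpe x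
  have hqe' : ∀ x, Nat.find (hex2 x) = q x := fun x => congrFun hqe x
  simp only [hpe'] at hp hp'
  simp only [hqe'] at hq hq'
  have hsep : ∀ x (a b : ℤ), T a x ∈ M → T b x ∈ M → a < b → ((4 * k * k : ℕ) : ℤ) < b - a := by
    intro x a b ha hb hab
    by_contra hcon
    refine hdis (T a x) (b - a) ?_ ?_ ha ?_
    · rw [abs_of_pos (by omega)]; omega
    · rw [abs_of_pos (by omega)]; omega
    · rw [← hadd]; simpa using hb
  have hL : ∀ x, 4 * k * k ≤ p x + q x := by
    intro x
    have := hsep x _ _ (hp x) (hq x).2 (by have := (hq x).1; omega)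
    omega
  have hbig : 2 * k ≤ 4 * k * k := by nlinarith
  have hlt : ∀ x, auxD k (p x + q x) (p x) / 2 < k := by
    intro x
    have h1 := auxD_lt k (p x + q x) (p x) hk
    have h2 := auxE_eq k (p x + q x) (p x)
    omega
  refine ⟨fun x => ⟨auxD k (p x + q x) (p x) / 2, hlt x⟩, ?_, ?_⟩
  · have hn : Measurable fun x => auxD k (p x + q x) (p x) / 2 :=
      (measurable_of_countable fun z : ℕ × ℕ => auxD k (z.1 + z.2) z.1 / 2).comp (mp.prodMk mq)
    refine measurable_to_countable' fun i => ?_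
    have : (fun x => (⟨auxD k (p x + q x) (p x) / 2, hlt x⟩ : Fin k)) ⁻¹' {i} =
        (fun x => auxD k (p x + q x) (p x) / 2) ⁻¹' {(i : ℕ)} := by
      ext x; simp [Fin.ext_iff]
    rw [this]
    exact hn (measurableSet_singleton _)
  · intro x s hs hs' heq
    have heq' : auxD k (p (T s x) + q (T s x)) (p (T s x)) / 2 =
      auxD k (p x + q x) (p x) / 2 := congrArg Fin.val heq
    refine aux_color k _ _ (auxE k (p x + q x) (p x)) s hk (auxE_eq _ _ _) hs hs' ?_ heq'
    have hpx := hp x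
    have hqx := hq x
    have hpy := hp (T s x)
    have hqy := hq (T s x)
    rw [← hadd] at hpy hqy
    by_cases hc : s < q x
    ·
      have e1 : p (T s x) = p x + s := by
        have h1 : p (T s x) ≤ p x + s := by
          apply hp'
          rw [← hadd]
          convert hpx using 2
          push_cast; ring
        by_contra hne
        by_cases h2 : s < p (T s x)
        · have := hp' x (p (T s x) - s) (by
            convert hpy using 2
            omega)
          omega
        · by_cases h3 : s = p (T s x)
          · have := hp' x 0 (by
              convert hpy using 2
              omega)
            omega
          · have := hq' x (s - p (T s x)) (by omega) (by
              convert hpy using 2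
              omega)
            omega
      have e2 : q (T s x) + s = q x := by
        have h1 : q (T s x) ≤ q x - s := by
          apply hq' _ _ (by omega)
          rw [← hadd]
          convert hqx.2 using 2
          omega
        have h2 := hq' x (q (T s x) + s) (by omega) (by
          convert hqy.2 using 2
          push_cast; ring)
        omega
      have e3 : p (T s x) + q (T s x) = p x + q x := by omega
      rw [e3, e1]
      exact aux_same k _ _ _ hk
    · right
      have h1 := aux_end k (p x + q x) (p x) hk (hL x) (by omega)
      have h2 := auxD_le k (p (T s x) + q (T s x)) (p (T s x))
      have h3 : p (T s x) ≤ s - q x := by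
        apply hp'
        rw [← hadd]
        convert hqx.2 using 2
        omega
      omega

theorem aux_upper (k : ℕ) (hk : 3 ≤ k) : HasBorelColoring (ShiftAdj (SK' k)) k := by
  classical
  have hinv : ∀ (n : ℤ) (x : FreePart (Multiplicative ℤ)),
      shiftMap (ofAdd n) (x : Multiplicative ℤ → Bool) ∈ FreePart (Multiplicative ℤ) := by
    intro n x g hg h
    refine x.2 g hg ?_
    funext t
    have := congrFun h (ofAdd n * t)
    simp only [shiftMap] at this ⊢
    rw [inv_mul_cancel_left, mul_left_comm, inv_mul_cancel_left] at this
    exact this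
  let T : ℤ → FreePart (Multiplicative ℤ) → FreePart (Multiplicative ℤ) :=
    fun n x => ⟨shiftMap (ofAdd n) x, hinv n x⟩
  have hTv : ∀ n x h, (T n x).1 h = x.1 ((ofAdd n)⁻¹ * h) := fun n x h => rfl
  have h0 : ∀ x, T 0 x = x := by
    intro x; apply Subtype.ext; funext h; rw [hTv]; simp
  have hadd : ∀ m n x, T (m + n) x = T m (T n x) := by
    intro m n x; apply Subtype.ext; funext h; rw [hTv, hTv, hTv]
    congr 1
    rw [ofAdd_add, mul_inv, mul_assoc, mul_left_comm]
  have hev : ∀ h, Measurable fun x : FreePart (Multiplicative ℤ) => x.1 h :=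
    fun h => (measurable_pi_apply h).comp measurable_subtype_coe
  have hm : ∀ n, Measurable (T n) := by
    intro n
    refine Measurable.subtype_mk (measurable_pi_lambda _ fun h => ?_)
    exact hev _
  set N : ℤ := ((4 * k * k : ℕ) : ℤ) with hN
  let V : Finset (Multiplicative ℤ) × Finset (Multiplicative ℤ) →
      Set (FreePart (Multiplicative ℤ)) := fun w =>
    {x | ∀ h ∈ w.1, x.1 h = decide (h ∈ w.2)} ∩
    {x | ∀ j : ℤ, 1 ≤ |j| → |j| ≤ N → ∃ h ∈ w.1, (T j x).1 h ≠ decide (h ∈ w.2)}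
  have hVm : ∀ w, MeasurableSet (V w) := by
    intro w
    have e1 : ∀ (j : ℤ) h, MeasurableSet {x : FreePart (Multiplicative ℤ) |
        (T j x).1 h = decide (h ∈ w.2)} := fun j h =>
      ((hev h).comp (hm j)) (measurableSet_singleton (decide (h ∈ w.2)))
    have e2 : ∀ h, MeasurableSet {x : FreePart (Multiplicative ℤ) |
        x.1 h = decide (h ∈ w.2)} := fun h =>
      (hev h) (measurableSet_singleton (decide (h ∈ w.2)))
    refine MeasurableSet.inter ?_ ?_
    · simp only [Set.setOf_forall]
      exact MeasurableSet.iInter fun h => MeasurableSet.iInter fun _ => e2 h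
    · simp only [Set.setOf_forall]
      refine MeasurableSet.iInter fun j => MeasurableSet.iInter fun _ =>
        MeasurableSet.iInter fun _ => ?_
      have : {x : FreePart (Multiplicative ℤ) | ∃ h ∈ w.1, (T j x).1 h ≠ decide (h ∈ w.2)} =
        ⋃ h ∈ w.1, {x : FreePart (Multiplicative ℤ) | (T j x).1 h = decide (h ∈ w.2)}ᶜ := by
        ext x; simp
      rw [this]
      exact MeasurableSet.iUnion fun h => MeasurableSet.iUnion fun _ => (e1 j h).compl
  obtain ⟨f, hf⟩ := exists_surjective_nat
    (Finset (Multiplicative ℤ) × Finset (Multiplicative ℤ))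
  obtain ⟨M, hM, hd, hmax⟩ := aux_marker T h0 hadd hm N (fun i => V (f i)) (fun i => hVm _)
    (by
      intro x
      have hx : ∀ j : ℤ, 1 ≤ |j| → ∃ h, (T j x).1 h ≠ x.1 h := by
        intro j hj
        have := x.2 (ofAdd j) (by
          intro h
          have : j = 0 := h
          simp [this] at hj)
        exact Function.ne_iff.1 this
      choose! H hH using hx
      let A : Finset (Multiplicative ℤ) := (Finset.Icc (-N) N).image H
      obtain ⟨i, hi⟩ := hf (A, A.filter fun h => x.1 h = true)
      refine ⟨i, ?_⟩
      simp only [hi]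
      have hA : ∀ h ∈ A, x.1 h = decide (h ∈ A.filter fun h => x.1 h = true) := by
        intro h hh
        simp [hh]
      refine ⟨hA, ?_⟩
      intro j h1 h2
      have hj : H j ∈ A := Finset.mem_image_of_mem _ (Finset.mem_Icc.2 (abs_le.1 h2))
      refine ⟨H j, hj, ?_⟩
      have := hH j h1
      rwa [hA _ hj] at this)
    (by
      intro i x j h1 h2 hx hy
      obtain ⟨h, hh, hne⟩ := hx.2 j h1 h2
      exact hne (hy.1 h hh))
  obtain ⟨c, hc, hcol⟩ := aux_main T h0 hadd hm k hk M hM hd (by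
    intro x
    obtain ⟨j, hj, hx⟩ := hmax x
    refine ⟨j, ?_, hx⟩
    rcases hj with hj | rfl
    · exact hj
    · rw [abs_zero]; positivity)
  refine ⟨c, hc, ?_⟩
  rintro x y ⟨-, s, ⟨hs1, hs2⟩, hy⟩ hxy
  have hy' : y = T (toAdd s) x := Subtype.ext hy
  rcases le_total 0 (toAdd s) with h | h
  · rw [abs_of_nonneg h] at hs1 hs2
    refine hcol x (toAdd s).toNat (by omega) (by omega) ?_
    rw [Int.toNat_of_nonneg h, ← hy']
    exact hxy.symm
  · rw [abs_of_nonpos h] at hs1 hs2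
    refine hcol y (-toAdd s).toNat (by omega) (by omega) ?_
    rw [Int.toNat_of_nonneg (by omega)]
    have : T (-toAdd s) y = x := by rw [hy', ← hadd, neg_add_cancel, h0]
    rw [this]
    exact hxy

theorem aux_lower (k n : ℕ) (hk : 3 ≤ k) (h : HasBorelColoring (ShiftAdj (SK' k)) n) :
    k ≤ n := by
  classical
  by_contra hlt
  obtain ⟨c, -, hc⟩ := h
  let x : ℤ → Multiplicative ℤ → Bool := fun n t => decide (t = ofAdd n)
  have hsh : ∀ (g : Multiplicative ℤ) n, shiftMap g (x n) = x (toAdd g + n) := by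
    intro g n
    funext t
    simp only [shiftMap, x, decide_eq_decide, inv_mul_eq_iff_eq_mul, ofAdd_add, ofAdd_toAdd]
  have hinj : ∀ m n, x m = x n → m = n := by
    intro m n h
    have := congrFun h (ofAdd m)
    simpa [x] using this
  have hfree : ∀ n, x n ∈ FreePart (Multiplicative ℤ) := by
    intro n g hg h
    rw [hsh] at h
    have h1 := hinj _ _ h
    apply hg
    have h2 : toAdd g = 0 := by omega
    exact h2
  let y : ℤ → FreePart (Multiplicative ℤ) := fun n => ⟨x n, hfree n⟩
  have key : ∀ a b : ℕ, a + 2 ≤ b → b ≤ a + (2 * k - 3) → c (y a) ≠ c (y b) := by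
    intro a b h1 h2
    apply hc
    refine ⟨?_, ofAdd ((b : ℤ) - a), ⟨?_, ?_⟩, ?_⟩
    · intro h
      have := hinj _ _ (congrArg Subtype.val h)
      omega
    · rw [toAdd_ofAdd, abs_of_nonneg (by omega)]; omega
    · rw [toAdd_ofAdd, abs_of_nonneg (by omega)]; omega
    · change x b = shiftMap _ (x a)
      rw [hsh]; simp
  obtain ⟨i, -, hi⟩ := Finset.exists_lt_card_fiber_of_mul_lt_card_of_maps_to
    (s := Finset.range (2 * k - 1)) (t := (Finset.univ : Finset (Fin n)))
    (f := fun a : ℕ => c (y a)) (n := 2) (fun _ _ => Finset.mem_univ _) (by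
      simp only [Finset.card_univ, Fintype.card_fin, Finset.card_range]; omega)
  obtain ⟨a, b, d, ha, hb, hd, hab, had, hbd⟩ := Finset.two_lt_card_iff.1 hi
  simp only [Finset.mem_filter, Finset.mem_range] at ha hb hd
  have key' : ∀ a b : ℕ, c (y a) = i → c (y b) = i → a < 2 * k - 1 → b < 2 * k - 1 →
      a < b → b = a + 1 ∨ (a = 0 ∧ b = 2 * k - 2) := by
    intro a b h1 h2 h3 h4 h5
    by_contra hcon
    exact key a b (by omega) (by omega) (h1.trans h2.symm)
  have k1 := key' a b ha.2 hb.2 ha.1 hb.1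
  have k2 := key' b a hb.2 ha.2 hb.1 ha.1
  have k3 := key' a d ha.2 hd.2 ha.1 hd.1
  have k4 := key' d a hd.2 ha.2 hd.1 ha.1
  have k5 := key' b d hb.2 hd.2 hb.1 hd.1
  have k6 := key' d b hd.2 hb.2 hd.1 hb.1
  have := ha.1
  have := hb.1
  have := hd.1
  clear hi key key' ha hb hd
  omega

/-- For `k ≥ 3`, the Borel chromatic number of the shift graph of
`(ℤ, {n : 2 ≤ |n| ≤ 2k-3})` equals `k`. -/
theorem borelChromatic_shift_GammaK' (k : ℕ) (hk : 3 ≤ k) :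
    borelChromatic (ShiftAdj (SK' k)) = k := by

  refine le_antisymm (Nat.sInf_le (aux_upper k hk)) ?_
  exact le_csInf ⟨k, aux_upper k hk⟩ fun n hn => aux_lower k n hk hn
end
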